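/- arXiv:2601.21167 — 4 statements merged into one kernel-verified Lean document; each statement's English description precedes it below -/
import Mathlib

section
/- Let μ̇ denote the derivative of the logistic function. For all real numbers z₁ and z₂, μ̇(z₂)·exp(−|z₂ − z₁|) ≤ μ̇(z₁) ≤ μ̇(z₂)·exp(|z₂ − z₁|). -/
/-- The logistic (sigmoid) function `μ(x) = 1/(1+exp(−x))`. -/
noncomputable def logistic (x : ℝ) : ℝ := (1 + Real.exp (-x))⁻¹

/-- `μ̇`, the derivative of the logistic function. -/
noncomputable def logisticDeriv : ℝ → ℝ := deriv logistic

theorem logisticDeriv_eq_inv (x : ℝ) :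
    logisticDeriv x = (2 + Real.exp x + Real.exp (-x))⁻¹ := by
  have h : logisticDeriv x = Real.sigmoid x * (1 - Real.sigmoid x) :=
    congrFun Real.deriv_sigmoid x
  rw [h, ← Real.sigmoid_neg, Real.sigmoid_def, Real.sigmoid_def, neg_neg, ← mul_inv]
  congr 1
  have : Real.exp (-x) * Real.exp x = 1 := by rw [← Real.exp_add]; simp
  linear_combination this

theorem logisticDeriv_le_mul_exp_abs (x y : ℝ) :
    logisticDeriv x ≤ logisticDeriv y * Real.exp |y - x| := by
  have h₁ : Real.exp y ≤ Real.exp x * Real.exp |y - x| := by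
    rw [← Real.exp_add, Real.exp_le_exp]
    linarith [le_abs_self (y - x)]
  have h₂ : Real.exp (-y) ≤ Real.exp (-x) * Real.exp |y - x| := by
    rw [← Real.exp_add, Real.exp_le_exp]
    linarith [neg_le_abs (y - x)]
  have h₃ : 1 ≤ Real.exp |y - x| := Real.one_le_exp (abs_nonneg _)
  rw [logisticDeriv_eq_inv, logisticDeriv_eq_inv, inv_mul_eq_div, le_div_iff₀ (by positivity),
    inv_mul_le_iff₀ (by positivity)]
  linarith

/-- For all real `z₁, z₂`:
`μ̇(z₂)·exp(−|z₂ − z₁|) ≤ μ̇(z₁) ≤ μ̇(z₂)·exp(|z₂ − z₁|)`. -/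
theorem logisticDeriv_relate (z₁ z₂ : ℝ) :
    logisticDeriv z₂ * Real.exp (-|z₂ - z₁|) ≤ logisticDeriv z₁ ∧
      logisticDeriv z₁ ≤ logisticDeriv z₂ * Real.exp |z₂ - z₁| := by
  refine ⟨?_, logisticDeriv_le_mul_exp_abs z₁ z₂⟩
  rw [Real.exp_neg, ← div_eq_mul_inv, div_le_iff₀ (Real.exp_pos _), abs_sub_comm]
  exact logisticDeriv_le_mul_exp_abs z₂ z₁
end

section
/- Let μ̇ denote the derivative of the logistic function. For all real numbers z₁ and z₂, ∫₀¹ (1 − v) · μ̇(z₁ + v(z₂ − z₁)) dv ≥ μ̇(z₁)/(2 + |z₁ − z₂|). -/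
theorem logisticDeriv_eq (x : ℝ) :
    logisticDeriv x = Real.exp (-x) / (1 + Real.exp (-x)) ^ 2 := by
  have hne : 1 + Real.exp (-x) ≠ 0 := by positivity
  have h : HasDerivAt (fun y : ℝ => 1 + Real.exp (-y)) (Real.exp (-x) * -1) x :=
    ((hasDerivAt_neg x).exp).const_add 1
  have h' : HasDerivAt logistic (-(Real.exp (-x) * -1) / (1 + Real.exp (-x)) ^ 2) x :=
    h.fun_inv hne
  rw [logisticDeriv, h'.deriv]
  ring

theorem continuous_logisticDeriv : Continuous logisticDeriv := by
  rw [funext logisticDeriv_eq]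
  exact Continuous.div (by fun_prop) (by fun_prop) fun x => by positivity

theorem logisticDeriv_pos (x : ℝ) : 0 < logisticDeriv x := by
  rw [logisticDeriv_eq]
  positivity

/-- The derivative of the logistic function decays at most exponentially with rate `1`. -/
theorem logisticDeriv_mul_exp_neg_abs_le (x t : ℝ) :
    logisticDeriv x * Real.exp (-|t|) ≤ logisticDeriv (x + t) := by
  rw [logisticDeriv_eq, logisticDeriv_eq, neg_add, Real.exp_add, div_mul_eq_mul_div]
  have hu := Real.exp_pos (-x)
  rcases le_total 0 t with ht | ht
  · rw [abs_of_nonneg ht]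
    have hw : Real.exp (-t) ≤ 1 := Real.exp_le_one_iff.2 (by linarith)
    gcongr
    exact mul_le_of_le_one_right hu.le hw
  · rw [abs_of_nonpos ht, neg_neg]
    have hw : 1 ≤ Real.exp (-t) := Real.one_le_exp (by linarith)
    have hmul : Real.exp t * Real.exp (-t) = 1 := by rw [← Real.exp_add]; simp
    generalize Real.exp (-x) = u at *
    generalize Real.exp (-t) = w at *
    have hw0 : 0 < w := by linarith
    rw [eq_div_of_mul_eq hw0.ne' hmul, div_le_div_iff₀ (by positivity) (by positivity)]
    have hsq : (1 + u * w) ^ 2 ≤ (w * (1 + u)) ^ 2 := by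
      gcongr
      linarith
    calc u * (1 / w) * (1 + u * w) ^ 2 ≤ u * (1 / w) * (w * (1 + u)) ^ 2 := by gcongr
      _ = u * w * (1 + u) ^ 2 := by field_simp

theorem two_sub_le_two_add_mul_exp_neg {a : ℝ} (ha : 0 ≤ a) :
    2 - a ≤ (2 + a) * Real.exp (-a) := by
  have hderiv (x : ℝ) : HasDerivAt (fun y : ℝ => (2 + y) * Real.exp (-y) + y)
      (1 * Real.exp (-x) + (2 + x) * (Real.exp (-x) * -1) + 1) x :=
    (((hasDerivAt_id x).const_add 2).mul (hasDerivAt_neg x).exp).add (hasDerivAt_id x)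
  have hmono : Monotone fun y : ℝ => (2 + y) * Real.exp (-y) + y := by
    refine monotone_of_hasDerivAt_nonneg hderiv fun x => ?_
    have hexp : Real.exp x * Real.exp (-x) = 1 := by rw [← Real.exp_add]; simp
    have := mul_le_mul_of_nonneg_right (Real.add_one_le_exp x) (Real.exp_pos (-x)).le
    simp only [Pi.zero_apply]
    linarith
  have := hmono ha
  simp only [add_zero, neg_zero, Real.exp_zero, mul_one] at this
  linarith

theorem integral_one_sub_mul_exp_neg_mul {a : ℝ} (ha : a ≠ 0) :
    ∫ v in (0:ℝ)..1, (1 - v) * Real.exp (-(v * a)) = (a - 1 + Real.exp (-a)) / a ^ 2 := by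
  have hderiv (v : ℝ) : HasDerivAt
      (fun v : ℝ => (1 / a ^ 2 - (1 - v) / a) * Real.exp (-(v * a)))
      ((1 - v) * Real.exp (-(v * a))) v := by
    have h := ((((hasDerivAt_id v).const_sub 1).div_const a).const_sub (1 / a ^ 2)).mul
      ((hasDerivAt_id v).mul_const a).neg.exp
    refine h.congr_deriv ?_
    simp only [id, Pi.neg_apply]
    field_simp
    ring
  rw [intervalIntegral.integral_eq_sub_of_hasDerivAt (fun v _ => hderiv v)
    ((by fun_prop : Continuous fun v : ℝ => (1 - v) * Real.exp (-(v * a))).intervalIntegrable _ _)]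
  simp
  field_simp
  ring

theorem one_div_two_add_le_integral {a : ℝ} (ha : 0 ≤ a) :
    1 / (2 + a) ≤ ∫ v in (0:ℝ)..1, (1 - v) * Real.exp (-(v * a)) := by
  rcases ha.eq_or_lt with rfl | hpos
  · simp only [mul_zero, neg_zero, Real.exp_zero, mul_one]
    rw [intervalIntegral.integral_sub (by simp) (by simp)]
    norm_num
  · rw [integral_one_sub_mul_exp_neg_mul hpos.ne', div_le_div_iff₀ (by positivity) (by positivity)]
    linarith [two_sub_le_two_add_mul_exp_neg ha]

/-- Second-order self-concordance control:
`∫₀¹ (1 − v)·μ̇(z₁ + v(z₂ − z₁)) dv ≥ μ̇(z₁)/(2 + |z₁ − z₂|)`. -/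
theorem logistic_second_order_self_concordance (z₁ z₂ : ℝ) :
    logisticDeriv z₁ / (2 + |z₁ - z₂|) ≤
      ∫ v in (0:ℝ)..1, (1 - v) * logisticDeriv (z₁ + v * (z₂ - z₁)) := by
  calc logisticDeriv z₁ / (2 + |z₁ - z₂|) = logisticDeriv z₁ * (1 / (2 + |z₁ - z₂|)) := by ring
    _ ≤ logisticDeriv z₁ * ∫ v in (0:ℝ)..1, (1 - v) * Real.exp (-(v * |z₁ - z₂|)) :=
      mul_le_mul_of_nonneg_left (one_div_two_add_le_integral (abs_nonneg _))
        (logisticDeriv_pos z₁).le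
    _ = ∫ v in (0:ℝ)..1, logisticDeriv z₁ * ((1 - v) * Real.exp (-(v * |z₁ - z₂|))) :=
      (intervalIntegral.integral_const_mul _ _).symm
    _ ≤ _ := by
      refine intervalIntegral.integral_mono_on zero_le_one ?_ ?_ fun v hv => ?_
      · exact Continuous.intervalIntegrable (by fun_prop) _ _
      · have := continuous_logisticDeriv
        exact Continuous.intervalIntegrable (by fun_prop) _ _
      · have h := logisticDeriv_mul_exp_neg_abs_le z₁ (v * (z₂ - z₁))
        rw [abs_mul, abs_of_nonneg hv.1, abs_sub_comm] at h
        rw [mul_left_comm]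
        exact mul_le_mul_of_nonneg_left h (sub_nonneg.2 hv.2)
end

section
/- (Reversed Bernstein inequality for martingales.) Let (X_t)_{t=1}^T be a real-valued stochastic process adapted to a filtration (ℱ_t) with 0 ≤ X_t ≤ 1 almost surely for each t. Let δ ∈ (0,1), set N := ⌊log₂(√T)⌋ + 1, c₁ := 3·√(log(N/δ)) and c₂ := 2·log(N/δ). Then with probability at least 1 − δ, Σ_{t=1}^T E[X_t | ℱ_{t−1}] ≤ (1/4)·( c₁ + √( c₁² + 4·(Σ_{t=1}^T X_t + c₂) ) )². -/
open MeasureTheory ProbabilityTheory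

lemma exp_neg_le_quadratic {y : ℝ} (hy : 0 ≤ y) : Real.exp (-y) ≤ 1 - y + y ^ 2 / 2 := by
  have h1 := Real.quadratic_le_exp_of_nonneg hy
  have h2 : 0 < 1 - y + y ^ 2 / 2 := by nlinarith [sq_nonneg (y - 1)]
  rw [Real.exp_neg, inv_le_comm₀ (Real.exp_pos y) h2]
  refine le_trans ?_ h1
  rw [inv_le_iff_one_le_mul₀' h2]
  nlinarith [sq_nonneg (y ^ 2)]

lemma exp_neg_mul_le_of_mem_Icc {l x : ℝ} (hl : 0 ≤ l) (hx : x ∈ Set.Icc (0 : ℝ) 1) :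
    Real.exp (-(l * x)) ≤ 1 - (l - l ^ 2 / 2) * x := by
  have h := exp_neg_le_quadratic (mul_nonneg hl hx.1)
  have h2 : x ^ 2 ≤ x := by nlinarith [hx.1, hx.2]
  nlinarith [mul_le_mul_of_nonneg_left h2 (sq_nonneg l)]

section Martingale

variable {Ω : Type*} {m0 : MeasurableSpace Ω} {μ : Measure Ω} [IsProbabilityMeasure μ]

lemma integrable_of_ae_mem_Icc {f : Ω → ℝ} (hf : AEStronglyMeasurable f μ)
    (hb : ∀ᵐ ω ∂μ, f ω ∈ Set.Icc (0 : ℝ) 1) : Integrable f μ := by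
  refine Integrable.of_bound hf 1 ?_
  filter_upwards [hb] with ω h
  rw [Real.norm_eq_abs, abs_le]
  constructor <;> linarith [h.1, h.2]

lemma condExp_ae_mem_Icc {m : MeasurableSpace Ω} (hm : m ≤ m0) {f : Ω → ℝ}
    (hf : AEStronglyMeasurable[m0] f μ) (hb : ∀ᵐ ω ∂μ, f ω ∈ Set.Icc (0 : ℝ) 1) :
    ∀ᵐ ω ∂μ, (μ[f|m]) ω ∈ Set.Icc (0 : ℝ) 1 := by
  have hi := integrable_of_ae_mem_Icc hf hb
  have h0 : 0 ≤ᵐ[μ] μ[f|m] := condExp_nonneg (hb.mono fun _ h => h.1)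
  have h1 : μ[f|m] ≤ᵐ[μ] μ[fun _ => (1 : ℝ)|m] :=
    condExp_mono hi (integrable_const _) (hb.mono fun _ h => h.2)
  rw [condExp_const hm] at h1
  filter_upwards [h0, h1] with ω a b using ⟨a, b⟩

lemma integral_mul_exp_neg_le {m : MeasurableSpace Ω} (hm : m ≤ m0) {g f : Ω → ℝ} {l C : ℝ}
    (hl : 0 ≤ l) (hf : AEStronglyMeasurable[m0] f μ) (hb : ∀ᵐ ω ∂μ, f ω ∈ Set.Icc (0 : ℝ) 1)
    (hg : StronglyMeasurable[m] g) (hg0 : ∀ ω, 0 ≤ g ω) (hgC : ∀ᵐ ω ∂μ, ‖g ω‖ ≤ C) :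
    ∫ ω, g ω * Real.exp ((l - l ^ 2 / 2) * (μ[f|m]) ω - l * f ω) ∂μ ≤ ∫ ω, g ω ∂μ := by
  set c := l - l ^ 2 / 2 with hc
  set p := μ[f|m] with hp
  have hpm : StronglyMeasurable[m] p := stronglyMeasurable_condExp
  have hfi := integrable_of_ae_mem_Icc hf hb
  have hpb := condExp_ae_mem_Icc hm hf hb
  set G : Ω → ℝ := fun ω => g ω * Real.exp (c * p ω) with hG
  have hGm : StronglyMeasurable[m] G :=
    hg.mul (Real.continuous_exp.comp_stronglyMeasurable (hpm.const_mul c))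
  have hG0 : ∀ ω, 0 ≤ G ω := fun ω => mul_nonneg (hg0 ω) (Real.exp_pos _).le
  have hGC : ∀ᵐ ω ∂μ, ‖G ω‖ ≤ C * Real.exp |c| := by
    filter_upwards [hgC, hpb] with ω h1 h2
    rw [hG, norm_mul, Real.norm_eq_abs (Real.exp _), Real.abs_exp]
    refine mul_le_mul h1 (Real.exp_le_exp.2 ?_) (Real.exp_pos _).le ((norm_nonneg _).trans h1)
    calc c * p ω ≤ |c| * p ω := mul_le_mul_of_nonneg_right (le_abs_self c) h2.1
      _ ≤ |c| := mul_le_of_le_one_right (abs_nonneg c) h2.2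
  have hGi : Integrable G μ := Integrable.of_bound (hGm.mono hm).aestronglyMeasurable _ hGC
  have hGf : Integrable (G * f) μ :=
    hfi.bdd_mul (hGm.mono hm).aestronglyMeasurable hGC
  have hGp : Integrable (G * p) μ :=
    integrable_condExp.bdd_mul (hGm.mono hm).aestronglyMeasurable hGC
  have hpull : ∫ ω, G ω * f ω ∂μ = ∫ ω, G ω * p ω ∂μ := by
    have h := condExp_mul_of_stronglyMeasurable_left hGm hGf hfi
    calc ∫ ω, G ω * f ω ∂μ = ∫ ω, (μ[G * f|m]) ω ∂μ := (integral_condExp hm).symm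
      _ = _ := integral_congr_ae h
  have hgi : Integrable g μ := Integrable.of_bound (hg.mono hm).aestronglyMeasurable _ hgC
  calc ∫ ω, g ω * Real.exp (c * p ω - l * f ω) ∂μ
      ≤ ∫ ω, (G ω - c * (G ω * f ω)) ∂μ := by
        refine integral_mono_of_nonneg
          (ae_of_all _ fun ω => mul_nonneg (hg0 ω) (Real.exp_pos _).le)
          (hGi.sub (hGf.const_mul c)) ?_
        filter_upwards [hb] with ω h
        have h1 := mul_le_mul_of_nonneg_left (exp_neg_mul_le_of_mem_Icc hl h) (hG0 ω)
        have h2 : g ω * Real.exp (c * p ω - l * f ω) = G ω * Real.exp (-(l * f ω)) := by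
          rw [hG, sub_eq_add_neg, Real.exp_add, mul_assoc]
        rw [← hc] at h1
        simp only [h2]
        linarith
    _ = ∫ ω, (G ω - c * (G ω * p ω)) ∂μ := by
        rw [integral_sub (g := fun ω => c * (G ω * f ω)) hGi (hGf.const_mul c),
          integral_sub (g := fun ω => c * (G ω * p ω)) hGi (hGp.const_mul c),
          integral_const_mul, integral_const_mul, hpull]
    _ ≤ ∫ ω, g ω ∂μ := by
        refine integral_mono (hGi.sub (hGp.const_mul c)) hgi fun ω => ?_
        have h1 := Real.add_one_le_exp (-(c * p ω))
        have h2 := mul_le_mul_of_nonneg_left h1 (hG0 ω)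
        have h3 : G ω * Real.exp (-(c * p ω)) = g ω := by
          rw [hG, mul_assoc, ← Real.exp_add, add_neg_cancel, Real.exp_zero, mul_one]
        simp only
        linarith

lemma integrable_and_integral_exp_sum_condExp_sub_le_one (ℱ : Filtration ℕ m0) (T : ℕ)
    {X : ℕ → Ω → ℝ}
    (hadapt : ∀ t ∈ Finset.Icc 1 T, StronglyMeasurable[ℱ t] (X t))
    (hbdd : ∀ t ∈ Finset.Icc 1 T, ∀ᵐ ω ∂μ, X t ω ∈ Set.Icc (0 : ℝ) 1)
    {l : ℝ} (hl : 0 ≤ l) :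
    Integrable (fun ω => Real.exp (∑ t ∈ Finset.Icc 1 T,
      ((l - l ^ 2 / 2) * (μ[X t|ℱ (t - 1)]) ω - l * X t ω))) μ ∧
    ∫ ω, Real.exp (∑ t ∈ Finset.Icc 1 T,
      ((l - l ^ 2 / 2) * (μ[X t|ℱ (t - 1)]) ω - l * X t ω)) ∂μ ≤ 1 := by
  set c := l - l ^ 2 / 2 with hc
  have key : ∀ n ≤ T,
      StronglyMeasurable[ℱ n] (fun ω => Real.exp (∑ t ∈ Finset.Icc 1 n,
        (c * (μ[X t|ℱ (t - 1)]) ω - l * X t ω))) ∧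
      (∀ᵐ ω ∂μ, ‖Real.exp (∑ t ∈ Finset.Icc 1 n,
        (c * (μ[X t|ℱ (t - 1)]) ω - l * X t ω))‖ ≤ Real.exp (n * |c|)) ∧
      ∫ ω, Real.exp (∑ t ∈ Finset.Icc 1 n,
        (c * (μ[X t|ℱ (t - 1)]) ω - l * X t ω)) ∂μ ≤ 1 := by
    intro n
    induction n with
    | zero =>
      intro _
      simpa using (stronglyMeasurable_const : StronglyMeasurable[ℱ 0] fun _ : Ω => (1 : ℝ))
    | succ n ih =>
      intro hn
      obtain ⟨h1, h2, h3⟩ := ih (by omega)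
      have hmem : n + 1 ∈ Finset.Icc 1 T := by simp; omega
      have hXm := ((hadapt _ hmem).mono (ℱ.le _)).aestronglyMeasurable (μ := μ)
      have heq : ∀ ω, Real.exp (∑ t ∈ Finset.Icc 1 (n + 1),
          (c * (μ[X t|ℱ (t - 1)]) ω - l * X t ω)) =
          Real.exp (∑ t ∈ Finset.Icc 1 n, (c * (μ[X t|ℱ (t - 1)]) ω - l * X t ω)) *
          Real.exp (c * (μ[X (n + 1)|ℱ n]) ω - l * X (n + 1) ω) := by
        intro ω
        rw [Finset.sum_Icc_succ_top (by omega), Real.exp_add, Nat.add_sub_cancel]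
      simp only [heq]
      refine ⟨?_, ?_, ?_⟩
      · have hp : StronglyMeasurable[ℱ (n + 1)] (μ[X (n + 1)|ℱ n]) :=
          stronglyMeasurable_condExp.mono (ℱ.mono n.le_succ)
        exact (h1.mono (ℱ.mono n.le_succ)).mul (Real.continuous_exp.comp_stronglyMeasurable
          ((hp.const_mul c).sub ((hadapt _ hmem).const_mul l)))
      · filter_upwards [h2, hbdd _ hmem, condExp_ae_mem_Icc (ℱ.le n) hXm (hbdd _ hmem)]
          with ω a b d
        rw [norm_mul, Nat.cast_succ, add_mul, Real.exp_add, one_mul]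
        refine mul_le_mul a ?_ (norm_nonneg _) (Real.exp_pos _).le
        rw [Real.norm_eq_abs, Real.abs_exp, Real.exp_le_exp]
        have e1 : c * (μ[X (n + 1)|ℱ n]) ω ≤ |c| :=
          (mul_le_mul_of_nonneg_right (le_abs_self c) d.1).trans
            (mul_le_of_le_one_right (abs_nonneg c) d.2)
        linarith [mul_nonneg hl b.1]
      · exact (integral_mul_exp_neg_le (ℱ.le n) hl hXm (hbdd _ hmem) h1
          (fun ω => (Real.exp_pos _).le) h2).trans h3
  obtain ⟨h1, h2, h3⟩ := key T le_rfl
  exact ⟨Integrable.of_bound (h1.mono (ℱ.le T)).aestronglyMeasurable _ h2, h3⟩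

lemma ofReal_one_sub_le_measure {B G : Set Ω} {δ : ℝ} (hδ0 : 0 ≤ δ) (hB : μ.real B ≤ δ)
    (hG : ∀ᵐ ω ∂μ, ω ∉ B → ω ∈ G) : ENNReal.ofReal (1 - δ) ≤ μ G := by
  have h1 : (1 : ENNReal) ≤ μ (B ∪ G) := by
    rw [← measure_univ (μ := μ)]
    refine measure_mono_ae ?_
    filter_upwards [hG] with ω h _
    by_cases hω : ω ∈ B
    · exact Or.inl hω
    · exact Or.inr (h hω)
  have h2 : μ B ≤ ENNReal.ofReal δ := by
    rw [← ofReal_measureReal]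
    exact ENNReal.ofReal_le_ofReal hB
  rw [ENNReal.ofReal_sub _ hδ0, ENNReal.ofReal_one, tsub_le_iff_left]
  exact h1.trans ((measure_union_le _ _).trans (add_le_add_left h2 _))

end Martingale

lemma le_sq_of_le_add_sqrt {S W L : ℝ} (hS : 0 ≤ S) (hL : 0 ≤ L)
    (h : S ≤ W + 3 * (Real.sqrt L * Real.sqrt S) + 2 * L) :
    S ≤ (1 / 4) * (3 * Real.sqrt L + Real.sqrt ((3 * Real.sqrt L) ^ 2 +
      4 * (W + 2 * L))) ^ 2 := by
  set s := Real.sqrt S with hs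
  set r := Real.sqrt L with hr
  have hs2 : s ^ 2 = S := Real.sq_sqrt hS
  have hr2 : r ^ 2 = L := Real.sq_sqrt hL
  have hs0 : 0 ≤ s := Real.sqrt_nonneg _
  have hr0 : 0 ≤ r := Real.sqrt_nonneg _
  have h1 : 2 * s - 3 * r ≤ Real.sqrt ((3 * r) ^ 2 + 4 * (W + 2 * L)) := by
    apply Real.le_sqrt_of_sq_le
    nlinarith
  have h2 : s ^ 2 ≤ ((3 * r + Real.sqrt ((3 * r) ^ 2 + 4 * (W + 2 * L))) / 2) ^ 2 :=
    pow_le_pow_left₀ hs0 (by linarith) 2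
  rw [hs2] at h2
  linarith

lemma le_add_sqrt_of_le_nine_mul {S W L : ℝ} (hS : 0 ≤ S) (hW : 0 ≤ W) (hL : 0 ≤ L)
    (h : S ≤ 9 * L) : S ≤ W + 3 * (Real.sqrt L * Real.sqrt S) + 2 * L := by
  have h1 : Real.sqrt S ≤ 3 * Real.sqrt L := by
    rw [Real.sqrt_le_left (by positivity), mul_pow, Real.sq_sqrt hL]
    linarith
  nlinarith [Real.sq_sqrt hS, Real.sqrt_nonneg S]

lemma le_add_sqrt_of_mul_sub_mul_le {S W L : ℝ} {i : ℕ} (hL : 0 < L)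
    (hi : (4 : ℝ) ^ i ≤ S) (hi' : S ≤ (4 : ℝ) ^ (i + 1))
    (h : (Real.sqrt L / 2 ^ i - (Real.sqrt L / 2 ^ i) ^ 2 / 2) * S - Real.sqrt L / 2 ^ i * W
      ≤ L) :
    S ≤ W + 3 * (Real.sqrt L * Real.sqrt S) + 2 * L := by
  have hS : 0 ≤ S := le_trans (by positivity) hi
  have h4 : ∀ j : ℕ, (4 : ℝ) ^ j = (2 ^ j) ^ 2 := fun j => by
    rw [← pow_mul, mul_comm, pow_mul]; norm_num
  set q : ℝ := 2 ^ i with hq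
  have hq0 : 0 < q := by positivity
  set r := Real.sqrt L with hr
  have hr0 : 0 < r := Real.sqrt_pos.2 hL
  have hr2 : r ^ 2 = L := Real.sq_sqrt hL.le
  set s := Real.sqrt S with hs
  have hs2 : s ^ 2 = S := Real.sq_sqrt hS
  have hs0 : 0 ≤ s := Real.sqrt_nonneg _
  have hqs : q ≤ s := Real.le_sqrt_of_sq_le (by rw [← h4]; exact hi)
  have hsq : s ≤ 2 * q := by
    rw [hs, Real.sqrt_le_left (by positivity)]
    rw [pow_succ, h4] at hi'
    linarith
  have h5 : S - r / q / 2 * S - W ≤ r * q := by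
    have : r / q * (S - r / q / 2 * S - W) ≤ r / q * (r * q) := by
      have e : r / q * (r * q) = L := by rw [← hr2]; field_simp
      rw [e]; linarith
    exact le_of_mul_le_mul_left this (by positivity)
  have h6 : r / q / 2 * S ≤ r * s := by
    rw [← hs2, div_div, div_mul_eq_mul_div, div_le_iff₀ (by positivity)]
    nlinarith [mul_nonneg (mul_nonneg hr0.le hs0) (sub_nonneg.2 hsq)]
  nlinarith [mul_le_mul_of_nonneg_left hqs hr0.le, mul_nonneg hr0.le hs0]

lemma exists_floor_logb_sqrt_eq (T : ℕ) :
    ∃ n : ℕ, ⌊Real.logb 2 (Real.sqrt T)⌋ = (n : ℤ) ∧ (T : ℝ) < 4 ^ (n + 1) := by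
  rcases Nat.eq_zero_or_pos T with rfl | hT
  · exact ⟨0, by simp, by simp⟩
  have hT1 : (1 : ℝ) ≤ T := by exact_mod_cast hT
  have hs : 1 ≤ Real.sqrt T := Real.one_le_sqrt.2 hT1
  have h0 : 0 ≤ ⌊Real.logb 2 (Real.sqrt T)⌋ :=
    Int.floor_nonneg.2 (Real.logb_nonneg (by norm_num) hs)
  obtain ⟨n, hn⟩ := Int.eq_ofNat_of_zero_le h0
  refine ⟨n, hn, ?_⟩
  have h1 := Int.lt_floor_add_one (Real.logb 2 (Real.sqrt T))
  rw [hn, Real.logb_lt_iff_lt_rpow (by norm_num) (by linarith)] at h1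
  have h2 : Real.sqrt T < 2 ^ (n + 1) := by
    rw [← Real.rpow_natCast]; push_cast at h1 ⊢; exact h1
  calc (T : ℝ) = Real.sqrt T ^ 2 := (Real.sq_sqrt (by linarith)).symm
    _ < (2 ^ (n + 1)) ^ 2 := pow_lt_pow_left₀ h2 (Real.sqrt_nonneg _) (by norm_num)
    _ = 4 ^ (n + 1) := by rw [← pow_mul, mul_comm, pow_mul]; norm_num

/-- Reversed Bernstein inequality for martingales. Let `(X_t)_{t=1}^T` be adapted to `(ℱ_t)` with
`0 ≤ X_t ≤ 1` a.s. With `N = ⌊log₂ √T⌋ + 1`, `c₁ = 3 √(log(N/δ))` and `c₂ = 2 log(N/δ)`,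
with probability at least `1 − δ`,
`Σ E[X_t | ℱ_{t−1}] ≤ (1/4)(c₁ + √(c₁² + 4 (Σ X_t + c₂)))²`. -/
theorem reversed_bernstein_inequality_for_martingales
    {Ω : Type*} {m0 : MeasurableSpace Ω} (Pr : Measure Ω) [IsProbabilityMeasure Pr]
    (ℱ : Filtration ℕ m0) (T : ℕ) (X : ℕ → Ω → ℝ)
    (hadapt : ∀ t ∈ Finset.Icc 1 T, StronglyMeasurable[ℱ t] (X t))
    (hbdd : ∀ t ∈ Finset.Icc 1 T, ∀ᵐ ω ∂Pr, X t ω ∈ Set.Icc (0 : ℝ) 1)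
    (δ : ℝ) (hδ : δ ∈ Set.Ioo (0 : ℝ) 1)
    (c₁ c₂ : ℝ)
    (hc₁ : c₁ = 3 * Real.sqrt (Real.log ((((⌊Real.logb 2 (Real.sqrt T)⌋ : ℤ) : ℝ) + 1) / δ)))
    (hc₂ : c₂ = 2 * Real.log ((((⌊Real.logb 2 (Real.sqrt T)⌋ : ℤ) : ℝ) + 1) / δ)) :
    ENNReal.ofReal (1 - δ) ≤
      Pr {ω | ∑ t ∈ Finset.Icc 1 T, (Pr[X t|ℱ (t - 1)]) ω ≤
        (1 / 4) * (c₁ + Real.sqrt (c₁ ^ 2 +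
          4 * (∑ t ∈ Finset.Icc 1 T, X t ω + c₂))) ^ 2} := by
  obtain ⟨hδ0, hδ1⟩ := hδ
  obtain ⟨n, hn, hT⟩ := exists_floor_logb_sqrt_eq T
  rw [hn, Int.cast_natCast] at hc₁ hc₂
  set L := Real.log (((n : ℝ) + 1) / δ) with hLdef
  subst hc₁ hc₂
  have hn0 : (0 : ℝ) ≤ n := n.cast_nonneg
  have hexpL : Real.exp L = (n + 1) / δ := Real.exp_log (by positivity)
  have hL : 0 < L := Real.log_pos (by rw [one_lt_div hδ0]; linarith)
  have hXm : ∀ t ∈ Finset.Icc 1 T, AEStronglyMeasurable (X t) Pr := fun t ht =>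
    ((hadapt t ht).mono (ℱ.le t)).aestronglyMeasurable
  have hXb : ∀ᵐ ω ∂Pr, ∀ t ∈ Finset.Icc 1 T, X t ω ∈ Set.Icc (0 : ℝ) 1 :=
    (Filter.eventually_all_finset _).2 hbdd
  have hpb : ∀ᵐ ω ∂Pr, ∀ t ∈ Finset.Icc 1 T, (Pr[X t|ℱ (t - 1)]) ω ∈ Set.Icc (0 : ℝ) 1 :=
    (Filter.eventually_all_finset _).2 fun t ht =>
      condExp_ae_mem_Icc (ℱ.le _) (hXm t ht) (hbdd t ht)
  set S : Ω → ℝ := fun ω => ∑ t ∈ Finset.Icc 1 T, (Pr[X t|ℱ (t - 1)]) ω with hSdef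
  set W : Ω → ℝ := fun ω => ∑ t ∈ Finset.Icc 1 T, X t ω with hWdef
  have hsum : ∀ f : ℕ → ℝ, (∀ t ∈ Finset.Icc 1 T, f t ∈ Set.Icc (0 : ℝ) 1) →
      0 ≤ ∑ t ∈ Finset.Icc 1 T, f t ∧ ∑ t ∈ Finset.Icc 1 T, f t ≤ T := fun f hf =>
    ⟨Finset.sum_nonneg fun t ht => (hf t ht).1,
      (Finset.sum_le_card_nsmul _ _ 1 fun t ht => (hf t ht).2).trans (by simp)⟩
  have hSb : ∀ᵐ ω ∂Pr, 0 ≤ S ω ∧ S ω ≤ T := hpb.mono fun ω h => hsum _ h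
  have hWb : ∀ᵐ ω ∂Pr, 0 ≤ W ω ∧ W ω ≤ T := hXb.mono fun ω h => hsum _ h
  suffices H : ∃ B : Set Ω, Pr.real B ≤ δ ∧ ∀ᵐ ω ∂Pr, 9 * L < S ω → ω ∉ B →
      S ω ≤ W ω + 3 * (Real.sqrt L * Real.sqrt (S ω)) + 2 * L by
    obtain ⟨B, hB, hgood⟩ := H
    refine ofReal_one_sub_le_measure hδ0.le hB ?_
    filter_upwards [hgood, hSb, hWb] with ω h hS hW hω
    refine le_sq_of_le_add_sqrt hS.1 hL.le ?_
    rcases le_or_gt (S ω) (9 * L) with h9 | h9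
    · exact le_add_sqrt_of_le_nine_mul hS.1 hW.1 hL.le h9
    · exact h h9 hω
  rcases Nat.eq_zero_or_pos n with rfl | hnpos
  · have hT3 : (T : ℝ) ≤ 3 := by
      have : T < 4 := by exact_mod_cast (by simpa using hT : (T : ℝ) < 4)
      exact_mod_cast (by omega : T ≤ 3)
    rcases le_or_gt (1 / 3) L with hL3 | hL3
    · refine ⟨∅, by simpa using hδ0.le, ?_⟩
      filter_upwards [hSb] with ω hS h9
      linarith [hS.2]
    · have hXi : ∀ t ∈ Finset.Icc 1 T, Integrable (X t) Pr := fun t ht =>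
        integrable_of_ae_mem_Icc (hXm t ht) (hbdd t ht)
      have hSi : Integrable S Pr := integrable_finsetSum _ fun t _ => integrable_condExp
      have hWi : Integrable W Pr := integrable_finsetSum _ hXi
      have hSW : ∫ ω, S ω ∂Pr = ∫ ω, W ω ∂Pr := by
        rw [hSdef, hWdef, integral_finsetSum _ fun t _ => integrable_condExp,
          integral_finsetSum _ hXi]
        exact Finset.sum_congr rfl fun t _ => integral_condExp (ℱ.le _)
      have hint : ∫ ω, (S ω - W ω + 3) ∂Pr = 3 := by
        rw [integral_add (f := fun ω => S ω - W ω) (hSi.sub hWi) (integrable_const _),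
          integral_sub hSi hWi, hSW]
        simp
      have hmk := mul_meas_ge_le_integral_of_nonneg (μ := Pr) (f := fun ω => S ω - W ω + 3)
        (by filter_upwards [hSb, hWb] with ω hS hW
            simp only [Pi.zero_apply]
            linarith [hS.1, hW.2]) ((hSi.sub hWi).add (integrable_const _)) (3 + 11 * L)
      rw [hint] at hmk
      refine ⟨{ω | 3 + 11 * L ≤ S ω - W ω + 3}, ?_, ?_⟩
      · have h1 : δ * Real.exp L = 1 := by rw [hexpL]; field_simp; simp
        have h2 := Real.add_one_le_exp (-L)
        have h3 : Real.exp (-L) = δ := by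
          rw [Real.exp_neg]; exact (eq_inv_of_mul_eq_one_left h1).symm
        rw [h3] at h2
        have h4 : 3 ≤ (3 + 11 * L) * δ := by nlinarith
        exact le_of_mul_le_mul_left (hmk.trans h4) (by positivity)
      · refine ae_of_all _ fun ω h9 hω => ?_
        simp only [Set.mem_ofPred_eq, not_le] at hω
        have h3 : 3 * Real.sqrt L ≤ Real.sqrt (S ω) := by
          apply Real.le_sqrt_of_sq_le
          rw [mul_pow, Real.sq_sqrt hL.le]
          linarith
        nlinarith [mul_le_mul_of_nonneg_left h3 (Real.sqrt_nonneg L), Real.sq_sqrt hL.le]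
  · have hn1 : (1 : ℝ) ≤ n := by exact_mod_cast hnpos
    have hL9 : 1 ≤ 9 * L := by
      have h1 : Real.log 2 ≤ L := by
        refine Real.log_le_log (by norm_num) ?_
        rw [le_div_iff₀ hδ0]
        linarith
      linarith [Real.log_two_gt_d9]
    set l : ℕ → ℝ := fun i => Real.sqrt L / 2 ^ i with hl
    set Y : ℕ → Ω → ℝ := fun i ω => Real.exp (∑ t ∈ Finset.Icc 1 T,
      ((l i - l i ^ 2 / 2) * (Pr[X t|ℱ (t - 1)]) ω - l i * X t ω)) with hY
    refine ⟨⋃ i ∈ Finset.range (n + 1), {ω | Real.exp L ≤ Y i ω}, ?_, ?_⟩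
    · have hB : ∀ i ∈ Finset.range (n + 1), Pr.real {ω | Real.exp L ≤ Y i ω} ≤ δ / (n + 1) := by
        intro i _
        obtain ⟨h1, h2⟩ := integrable_and_integral_exp_sum_condExp_sub_le_one (μ := Pr) ℱ T
          hadapt hbdd (l := l i) (by positivity)
        have h3 := (mul_meas_ge_le_integral_of_nonneg
          (ae_of_all _ fun ω => (Real.exp_pos _).le) h1 (Real.exp L)).trans h2
        rw [← le_div_iff₀' (Real.exp_pos _)] at h3
        exact h3.trans_eq (by rw [hexpL, one_div_div])
      refine (measureReal_biUnion_finset_le _ _).trans ((Finset.sum_le_sum hB).trans ?_)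
      rw [Finset.sum_const, Finset.card_range, nsmul_eq_mul]
      push_cast
      rw [mul_div_cancel₀ _ (by positivity)]
    · filter_upwards [hSb] with ω hS h9 hω
      obtain ⟨i, hi1, hi2⟩ := exists_nat_pow_near (hL9.trans h9.le) (by norm_num : (1 : ℝ) < 4)
      have hin : i < n + 1 :=
        (pow_lt_pow_iff_right₀ (by norm_num : (1 : ℝ) < 4)).1 ((hi1.trans hS.2).trans_lt hT)
      simp only [Set.mem_iUnion, Finset.mem_range, Set.mem_ofPred_eq, not_exists, not_le] at hω
      have h1 := hω i hin
      rw [hY, Real.exp_lt_exp, Finset.sum_sub_distrib, ← Finset.mul_sum, ← Finset.mul_sum] at h1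
      exact le_add_sqrt_of_mul_sub_mul_le hL hi1 hi2.le h1.le
end

section
/- Let T ≥ 2 and let (X_t)_{t=1}^T be a real-valued stochastic process adapted to a filtration (ℱ_t) with 0 ≤ X_t ≤ 1 almost surely for each t. Then for every δ ∈ (0,1), with probability at least 1 − δ, Σ_{t=1}^T E[X_t | ℱ_{t−1}] ≤ ( 4·√(log((2·log T)/δ)) + √(Σ_{t=1}^T X_t) )². -/
open MeasureTheory ProbabilityTheory

/-- One step of the exponential supermartingale: multiplying a bounded nonnegative past-measurable
weight by `exp (-a X + (1 - exp (-a)) E[X | m])` does not increase its mean. -/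
lemma integral_mul_exp_condExp_le {Ω : Type*} {m m0 : MeasurableSpace Ω} (hm : m ≤ m0)
    {Pr : Measure Ω} [IsProbabilityMeasure Pr] {a C : ℝ} (ha : 0 ≤ a) {X Z : Ω → ℝ}
    (hX : AEStronglyMeasurable X Pr) (hX01 : ∀ᵐ ω ∂Pr, X ω ∈ Set.Icc (0 : ℝ) 1)
    (hZ : StronglyMeasurable[m] Z) (hZ0 : ∀ ω, 0 ≤ Z ω) (hZC : ∀ᵐ ω ∂Pr, Z ω ≤ C) :
    (∀ᵐ ω ∂Pr, Z ω * Real.exp (-a * X ω + (1 - Real.exp (-a)) * (Pr[X|m]) ω)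
      ≤ C * Real.exp 1) ∧
    ∫ ω, Z ω * Real.exp (-a * X ω + (1 - Real.exp (-a)) * (Pr[X|m]) ω) ∂Pr ≤ ∫ ω, Z ω ∂Pr := by
  have hXint : Integrable X Pr := Integrable.of_mem_Icc 0 1 hX.aemeasurable hX01
  have hmu0 : ∀ᵐ ω ∂Pr, 0 ≤ (Pr[X|m]) ω :=
    condExp_nonneg (hX01.mono fun ω h => h.1)
  have hmu1 : ∀ᵐ ω ∂Pr, (Pr[X|m]) ω ≤ 1 := by
    have h := condExp_mono (m := m) hXint (integrable_const (1 : ℝ)) (hX01.mono fun ω h => h.2)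
    rwa [condExp_const hm] at h
  set c := 1 - Real.exp (-a) with hc
  have hc0 : 0 ≤ c := by
    have := Real.exp_le_one_iff.2 (neg_nonpos.2 ha)
    linarith
  have hc1 : c ≤ 1 := by
    have := Real.exp_pos (-a)
    linarith
  have hmuSM : StronglyMeasurable[m] (Pr[X|m]) := stronglyMeasurable_condExp
  set W : Ω → ℝ := fun ω => Z ω * Real.exp (c * (Pr[X|m]) ω) with hW
  have hWSM : StronglyMeasurable[m] W :=
    hZ.mul (Real.continuous_exp.comp_stronglyMeasurable (hmuSM.const_mul c))
  have hW0 : ∀ ω, 0 ≤ W ω := fun ω => mul_nonneg (hZ0 ω) (Real.exp_pos _).le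
  have hWC : ∀ᵐ ω ∂Pr, W ω ≤ C * Real.exp 1 := by
    filter_upwards [hmu1, hmu0, hZC] with ω h1 h0 hz
    exact mul_le_mul hz (Real.exp_le_exp.2 (by nlinarith)) (Real.exp_pos _).le ((hZ0 ω).trans hz)
  have hWint : Integrable W Pr := Integrable.of_mem_Icc 0 (C * Real.exp 1)
    (hWSM.mono hm).measurable.aemeasurable (hWC.mono fun ω h => ⟨hW0 ω, h⟩)
  have hZint : Integrable Z Pr := Integrable.of_mem_Icc 0 C
    (hZ.mono hm).measurable.aemeasurable (hZC.mono fun ω h => ⟨hZ0 ω, h⟩)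
  have hbddW : ∀ᵐ ω ∂Pr, ‖W ω‖ ≤ C * Real.exp 1 := by
    filter_upwards [hWC] with ω h
    rwa [Real.norm_of_nonneg (hW0 ω)]
  have hWX : Integrable (W * X) Pr := hXint.bdd_mul (hWSM.mono hm).aestronglyMeasurable hbddW
  have hWmu : Integrable (W * Pr[X|m]) Pr :=
    integrable_condExp.bdd_mul (hWSM.mono hm).aestronglyMeasurable hbddW
  have hpull : ∫ ω, (W * X) ω ∂Pr = ∫ ω, (W * Pr[X|m]) ω ∂Pr := by
    rw [← integral_condExp hm]
    exact integral_congr_ae (condExp_mul_of_stronglyMeasurable_left hWSM hWX hXint)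
  have hsplit : ∀ ω, Z ω * Real.exp (-a * X ω + c * (Pr[X|m]) ω) =
      W ω * Real.exp (-a * X ω) := fun ω => by
    rw [hW, Real.exp_add]; ring
  have hconv : ∀ x ∈ Set.Icc (0 : ℝ) 1, Real.exp (-a * x) ≤ 1 - c * x := fun x hx => by
    have h := convexOn_exp.2 (Set.mem_univ 0) (Set.mem_univ (-a)) (sub_nonneg.2 hx.2) hx.1
      (by ring)
    simp only [smul_eq_mul, mul_zero, zero_add, Real.exp_zero, mul_one] at h
    rw [mul_comm (-a) x]
    refine h.trans_eq ?_
    rw [hc]; ring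
  simp_rw [hsplit]
  constructor
  · filter_upwards [hWC, hX01] with ω h hx
    refine (mul_le_of_le_one_right (hW0 ω) (Real.exp_le_one_iff.2 ?_)).trans h
    nlinarith [hx.1]
  · calc ∫ ω, W ω * Real.exp (-a * X ω) ∂Pr
        ≤ ∫ ω, (W ω - c * (W * X) ω) ∂Pr := by
          refine integral_mono_of_nonneg
            (.of_forall fun ω => mul_nonneg (hW0 ω) (Real.exp_pos _).le)
            (hWint.sub (hWX.const_mul c)) ?_
          filter_upwards [hX01] with ω hx
          have := mul_le_mul_of_nonneg_left (hconv _ hx) (hW0 ω)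
          simp only [Pi.mul_apply]
          linarith
      _ = ∫ ω, (W ω - c * (W * Pr[X|m]) ω) ∂Pr := by
          rw [integral_sub hWint (hWX.const_mul c), integral_sub hWint (hWmu.const_mul c),
            integral_const_mul, integral_const_mul, hpull]
      _ ≤ ∫ ω, Z ω ∂Pr := by
          refine integral_mono (hWint.sub (hWmu.const_mul c)) hZint fun ω => ?_
          have h1 : 1 - c * (Pr[X|m]) ω ≤ Real.exp (-(c * (Pr[X|m]) ω)) :=
            Real.one_sub_le_exp_neg _
          have h2 := mul_le_mul_of_nonneg_left h1 (hW0 ω)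
          have h3 : W ω * Real.exp (-(c * (Pr[X|m]) ω)) = Z ω := by
            rw [hW]
            simp only
            rw [mul_assoc, ← Real.exp_add, add_neg_cancel, Real.exp_zero, mul_one]
          simp only [Pi.mul_apply]
          linarith

/-- Exponential tail bound for the compensator of a `[0, 1]`-valued adapted process. -/
lemma measureReal_compensator_ge_le {Ω : Type*} {m0 : MeasurableSpace Ω} (Pr : Measure Ω)
    [IsProbabilityMeasure Pr] (ℱ : Filtration ℕ m0) (T : ℕ) (X : ℕ → Ω → ℝ)
    (hadapt : ∀ t ∈ Finset.Icc 1 T, StronglyMeasurable[ℱ t] (X t))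
    (hbdd : ∀ t ∈ Finset.Icc 1 T, ∀ᵐ ω ∂Pr, X t ω ∈ Set.Icc (0 : ℝ) 1)
    {a : ℝ} (ha : 0 ≤ a) (L : ℝ) :
    Pr.real {ω | L ≤ -a * ∑ t ∈ Finset.Icc 1 T, X t ω +
      (1 - Real.exp (-a)) * ∑ t ∈ Finset.Icc 1 T, (Pr[X t|ℱ (t - 1)]) ω} ≤ Real.exp (-L) := by
  set E : ℕ → Ω → ℝ := fun n ω => -a * ∑ t ∈ Finset.Icc 1 n, X t ω +
      (1 - Real.exp (-a)) * ∑ t ∈ Finset.Icc 1 n, (Pr[X t|ℱ (t - 1)]) ω with hE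
  have key : ∀ n ≤ T, StronglyMeasurable[ℱ n] (fun ω => Real.exp (E n ω)) ∧
      (∃ C, ∀ᵐ ω ∂Pr, Real.exp (E n ω) ≤ C) ∧ ∫ ω, Real.exp (E n ω) ∂Pr ≤ 1 := by
    intro n
    induction n with
    | zero =>
      intro _
      simp only [hE, Finset.Icc_eq_empty_of_lt zero_lt_one, Finset.sum_empty, mul_zero, add_zero,
        Real.exp_zero]
      exact ⟨stronglyMeasurable_const, ⟨1, by simp⟩, by simp⟩
    | succ n ih =>
      intro hn
      obtain ⟨hSM, ⟨C, hC⟩, hint⟩ := ih (by omega)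
      have hmem : n + 1 ∈ Finset.Icc 1 T := Finset.mem_Icc.2 ⟨by omega, hn⟩
      have hstep : ∀ ω, Real.exp (E (n + 1) ω) = Real.exp (E n ω) *
          Real.exp (-a * X (n + 1) ω + (1 - Real.exp (-a)) * (Pr[X (n + 1)|ℱ n]) ω) := fun ω => by
        rw [← Real.exp_add, hE]
        simp only [Finset.sum_Icc_succ_top (Nat.le_add_left 1 n), Nat.add_sub_cancel]
        congr 1
        ring
      obtain ⟨h1, h2⟩ := integral_mul_exp_condExp_le (ℱ.le n) ha
        ((hadapt _ hmem).mono (ℱ.le _)).aestronglyMeasurable (hbdd _ hmem) hSM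
        (fun ω => (Real.exp_pos _).le) hC
      simp_rw [hstep]
      refine ⟨?_, ⟨_, h1⟩, h2.trans hint⟩
      have hle := ℱ.mono n.le_succ
      exact (hSM.mono hle).mul (Real.continuous_exp.comp_stronglyMeasurable
        (((hadapt _ hmem).const_mul (-a)).add
          ((stronglyMeasurable_condExp.mono hle).const_mul _)))
  obtain ⟨hSM, ⟨C, hC⟩, hint⟩ := key T le_rfl
  have hI : Integrable (fun ω => Real.exp (E T ω)) Pr := Integrable.of_mem_Icc 0 C
    (hSM.mono (ℱ.le T)).measurable.aemeasurable (hC.mono fun ω h => ⟨(Real.exp_pos _).le, h⟩)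
  have hM := mul_meas_ge_le_integral_of_nonneg
    (.of_forall fun ω => (Real.exp_pos (E T ω)).le) hI (Real.exp L)
  simp only [Real.exp_le_exp] at hM
  rw [Real.exp_neg L, ← one_div (Real.exp L), le_div_iff₀' (Real.exp_pos L)]
  exact hM.trans hint

/-- If `S` lies in the window `[(ℓ/a)², (4ℓ/a)²]` and exceeds `(4 ℓ + √Y)²`, the exponent with
parameter `a` is at least `ℓ²`. -/
lemma sq_le_exponent_of_lt {a l S Y : ℝ} (ha : 0 < a) (hl : 0 ≤ l) (hY : 0 ≤ Y)
    (hSY : (4 * l + √Y) ^ 2 < S) (hlow : l ≤ a * √S) (hup : a * √S ≤ 4 * l) :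
    l ^ 2 ≤ -a * Y + (1 - Real.exp (-a)) * S := by
  have hS : 0 ≤ S := (sq_nonneg _).trans hSY.le
  have hexp : Real.exp (-a) ≤ 1 - a + a ^ 2 / 2 := by
    rw [Real.exp_neg]
    refine inv_le_of_inv_le₀ (by nlinarith [sq_nonneg (a - 1)]) ?_
    refine le_trans ?_ (Real.quadratic_le_exp_of_nonneg ha.le)
    rw [inv_le_iff_one_le_mul₀ (by nlinarith [sq_nonneg (a - 1)])]
    nlinarith [sq_nonneg (a ^ 2)]
  have hp : 4 * l + √Y ≤ √S := Real.le_sqrt_of_sq_le hSY.le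
  have hSe := Real.sq_sqrt hS
  have hYe := Real.sq_sqrt hY
  have hq := Real.sqrt_nonneg Y
  set p := √S
  set q := √Y
  have h1 : 4 * p * l ≤ S - Y := by
    rw [← hSe, ← hYe]
    nlinarith [mul_nonneg hl hq]
  have h2 : a * S - a ^ 2 / 2 * S ≤ (1 - Real.exp (-a)) * S := by nlinarith
  have h3 := mul_le_mul_of_nonneg_left h1 ha.le
  have h4 : a ^ 2 * S = (a * p) ^ 2 := by rw [← hSe]; ring
  nlinarith [mul_nonneg (sub_nonneg.2 hlow) hl, mul_nonneg (hl.trans hlow) (sub_nonneg.2 hup)]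

/-- Corollary of the reversed Bernstein inequality: for `T ≥ 2` and `(X_t)_{t=1}^T` adapted
with `0 ≤ X_t ≤ 1` a.s., with probability at least `1 − δ`,
`Σ E[X_t | ℱ_{t−1}] ≤ (4 √(log((2 log T)/δ)) + √(Σ X_t))²`. -/
theorem reversed_bernstein_corollary
    {Ω : Type*} {m0 : MeasurableSpace Ω} (Pr : Measure Ω) [IsProbabilityMeasure Pr]
    (ℱ : Filtration ℕ m0) (T : ℕ) (hT : 2 ≤ T) (X : ℕ → Ω → ℝ)
    (hadapt : ∀ t ∈ Finset.Icc 1 T, StronglyMeasurable[ℱ t] (X t))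
    (hbdd : ∀ t ∈ Finset.Icc 1 T, ∀ᵐ ω ∂Pr, X t ω ∈ Set.Icc (0 : ℝ) 1)
    (δ : ℝ) (hδ : δ ∈ Set.Ioo (0 : ℝ) 1) :
    ENNReal.ofReal (1 - δ) ≤
      Pr {ω | ∑ t ∈ Finset.Icc 1 T, (Pr[X t|ℱ (t - 1)]) ω ≤
        (4 * Real.sqrt (Real.log ((2 * Real.log T) / δ)) +
          Real.sqrt (∑ t ∈ Finset.Icc 1 T, X t ω)) ^ 2} := by
  obtain ⟨hδ0, hδ1⟩ := hδ
  have hlog2 : 0.69 < Real.log 2 := by linarith [Real.log_two_gt_d9]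
  have hlogT : Real.log 2 ≤ Real.log T := Real.log_le_log two_pos (by exact_mod_cast hT)
  have hlogT0 : 0 < Real.log T := by linarith
  set L := Real.log ((2 * Real.log T) / δ) with hL
  have hL16 : 1 / 16 ≤ L := by
    rw [hL, Real.le_log_iff_exp_le (by positivity), le_div_iff₀ hδ0]
    have h1 : Real.exp (1 / 16) ≤ 1 / (1 - 1 / 16) := Real.exp_bound_div_one_sub_of_interval
      (by norm_num) (by norm_num)
    nlinarith [Real.exp_pos (1 / 16)]
  have hexpL : Real.exp (-L) = δ / (2 * Real.log T) := by
    rw [Real.exp_neg, hL, Real.exp_log (by positivity), inv_div]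
  set K := Nat.log 16 T + 1 with hK
  have hTK : (T : ℝ) < 16 ^ K := by
    exact_mod_cast Nat.lt_pow_succ_log_self (by norm_num : 1 < 16) T
  have hKT : (K : ℝ) ≤ 2 * Real.log T := by
    have h1 : ((16 : ℝ) ^ Nat.log 16 T) ≤ T := by
      exact_mod_cast Nat.pow_log_le_self 16 (by omega : T ≠ 0)
    have h2 := Real.log_le_log (by positivity) h1
    rw [Real.log_pow, show (16 : ℝ) = 2 ^ 4 by norm_num, Real.log_pow] at h2
    have h3 : (0 : ℝ) ≤ Nat.log 16 T := by positivity
    push_cast [hK] at h2 ⊢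
    nlinarith
  set S : Ω → ℝ := fun ω => ∑ t ∈ Finset.Icc 1 T, (Pr[X t|ℱ (t - 1)]) ω with hS
  set Y : Ω → ℝ := fun ω => ∑ t ∈ Finset.Icc 1 T, X t ω with hY
  set B : ℕ → Set Ω := fun k => {ω | L ≤ -((1 / 4 : ℝ) ^ (k + 1)) * Y ω +
    (1 - Real.exp (-((1 / 4 : ℝ) ^ (k + 1)))) * S ω} with hB
  have hBk : ∀ k, Pr.real (B k) ≤ δ / (2 * Real.log T) := fun k => by
    rw [← hexpL]
    exact measureReal_compensator_ge_le Pr ℱ T X hadapt hbdd (by positivity) L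
  have hae : ∀ᵐ ω ∂Pr, 0 ≤ Y ω ∧ S ω ≤ T := by
    have hX : ∀ᵐ ω ∂Pr, ∀ t ∈ Finset.Icc 1 T, X t ω ∈ Set.Icc (0 : ℝ) 1 := by
      rwa [Finset.eventually_all]
    have hmu : ∀ᵐ ω ∂Pr, ∀ t ∈ Finset.Icc 1 T, (Pr[X t|ℱ (t - 1)]) ω ≤ 1 := by
      rw [Finset.eventually_all]
      intro t ht
      have hm := ((hadapt t ht).mono (ℱ.le t)).measurable.aemeasurable (μ := Pr)
      have h := condExp_mono (m := ℱ (t - 1)) (Integrable.of_mem_Icc 0 1 hm (hbdd t ht))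
        (integrable_const (1 : ℝ)) ((hbdd t ht).mono fun ω h => h.2)
      rwa [condExp_const (ℱ.le _)] at h
    filter_upwards [hX, hmu] with ω hx hm
    refine ⟨Finset.sum_nonneg fun t ht => (hx t ht).1, ?_⟩
    simpa using Finset.sum_le_sum hm
  set A : Set Ω := {ω | S ω ≤ (4 * √L + √(Y ω)) ^ 2} with hA
  have hcover : Aᶜ ≤ᵐ[Pr] (⋃ k ∈ Finset.range K, B k : Set Ω) := by
    filter_upwards [hae] with ω ⟨hy, hs⟩ hω
    have hlt : (4 * √L + √(Y ω)) ^ 2 < S ω := not_le.1 hω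
    have hLs : √L ^ 2 = L := Real.sq_sqrt (by linarith)
    have hLS : 16 * L ≤ S ω := by
      nlinarith [mul_nonneg (Real.sqrt_nonneg L) (Real.sqrt_nonneg (Y ω)),
        sq_nonneg (√(Y ω))]
    obtain ⟨k, hk1, hk2⟩ := exists_nat_pow_near (x := S ω / (16 * L)) (y := 16)
      ((one_le_div (by linarith)).2 hLS) (by norm_num)
    have hkK : k < K := by
      have h1 : (16 : ℝ) ^ k < 16 ^ K := by
        refine (hk1.trans ((div_le_self (by linarith) (by linarith)).trans hs)).trans_lt hTK
      exact (pow_lt_pow_iff_right₀ (by norm_num)).1 h1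
    rw [le_div_iff₀ (by linarith)] at hk1
    rw [div_lt_iff₀ (by linarith)] at hk2
    have hroot : ∀ j : ℕ, √(16 ^ j * (16 * L)) = 4 ^ (j + 1) * √L := fun j => by
      rw [show (16 : ℝ) ^ j * (16 * L) = (4 ^ (j + 1)) ^ 2 * L by
        rw [← pow_mul, mul_comm (j + 1) 2, pow_mul, pow_succ]; norm_num; ring,
        Real.sqrt_mul (by positivity), Real.sqrt_sq (by positivity)]
    have hr1 := Real.sqrt_le_sqrt hk1
    have hr2 := Real.sqrt_le_sqrt hk2.le
    rw [hroot] at hr1 hr2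
    have hcancel : (1 / 4 : ℝ) ^ (k + 1) * 4 ^ (k + 1) = 1 := by
      rw [← mul_pow]; norm_num
    refine Set.mem_biUnion (Finset.mem_coe.2 (Finset.mem_range.2 hkK)) ?_
    change L ≤ _
    rw [← hLs]
    have ha : (0 : ℝ) < (1 / 4) ^ (k + 1) := by positivity
    refine sq_le_exponent_of_lt ha (Real.sqrt_nonneg L) hy hlt ?_ ?_
    · calc √L = (1 / 4 : ℝ) ^ (k + 1) * (4 ^ (k + 1) * √L) := by rw [← mul_assoc, hcancel, one_mul]
        _ ≤ _ := mul_le_mul_of_nonneg_left hr1 ha.le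
    · calc _ ≤ (1 / 4 : ℝ) ^ (k + 1) * (4 ^ (k + 1 + 1) * √L) :=
            mul_le_mul_of_nonneg_left hr2 ha.le
        _ = ((1 / 4 : ℝ) ^ (k + 1) * 4 ^ (k + 1)) * (4 * √L) := by rw [pow_succ 4 (k + 1)]; ring
        _ = 4 * √L := by rw [hcancel, one_mul]
  have hbad : Pr.real Aᶜ ≤ δ := by
    calc Pr.real Aᶜ ≤ Pr.real (⋃ k ∈ Finset.range K, B k) :=
          ENNReal.toReal_mono (measure_ne_top _ _) (measure_mono_ae hcover)
      _ ≤ ∑ k ∈ Finset.range K, Pr.real (B k) := measureReal_biUnion_finset_le _ _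
      _ ≤ ∑ _k ∈ Finset.range K, δ / (2 * Real.log T) := Finset.sum_le_sum fun k _ => hBk k
      _ = K * (δ / (2 * Real.log T)) := by simp
      _ ≤ 2 * Real.log T * (δ / (2 * Real.log T)) :=
          mul_le_mul_of_nonneg_right hKT (by positivity)
      _ = δ := mul_div_cancel₀ _ (by positivity)
  have hone : 1 ≤ Pr.real A + Pr.real Aᶜ := by
    have h := measureReal_union_le (μ := Pr) A Aᶜ
    rwa [Set.union_compl_self, probReal_univ] at h
  exact ENNReal.ofReal_le_of_le_toReal (by change 1 - δ ≤ Pr.real A; linarith)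
end
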